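/- (Absence of deadlocks.) Let G be a priority graph with Φ(χ^free_G) ≠ ∅. Then for every configuration x ∈ χ^free_G there exists a path φ ∈ Φ(χ^free_G) passing through x, i.e., φ(t) = x for some t ∈ [0,1]. -/

import Mathlib

open Set

noncomputable section

/-- Canonical basis vector `e i` of the coordination space `ℝ^n`. -/
def basisVec (n : ℕ) (i : Fin n) : Fin n → ℝ := Pi.single i 1

/-- Collision cylinder `χ^obs_{ij} = {x : (x i, x j) ∈ κ i j}`. -/
def cyl (n : ℕ) (κ : Fin n → Fin n → Set (ℝ × ℝ)) (i j : Fin n) : Set (Fin n → ℝ) :=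
  {x | (x i, x j) ∈ κ i j}

/-- Completed cylinder `χ^obs_{i≻j} = χ^obs_{ij} − ℝ₊ e_i + ℝ₊ e_j` (Minkowski sums). -/
def cylPr (n : ℕ) (κ : Fin n → Fin n → Set (ℝ × ℝ)) (i j : Fin n) : Set (Fin n → ℝ) :=
  {z | ∃ y ∈ cyl n κ i j, ∃ a b : ℝ, 0 ≤ a ∧ 0 ≤ b ∧
    z = y - a • basisVec n i + b • basisVec n j}

/-- Obstacle region `χ^obs = ⋃_{i,j} χ^obs_{ij}`. -/
def obsRegion (n : ℕ) (κ : Fin n → Fin n → Set (ℝ × ℝ)) : Set (Fin n → ℝ) :=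
  ⋃ i, ⋃ j, cyl n κ i j

/-- Obstacle-free region `χ^free = χ \ χ^obs`. -/
def freeRegion (n : ℕ) (κ : Fin n → Fin n → Set (ℝ × ℝ)) : Set (Fin n → ℝ) :=
  (obsRegion n κ)ᶜ

/-- Standing hypotheses on the collision data `κ`: each `κ i j` is open, bounded and
convex, `κ i i = ∅`, and `(a,b) ∈ κ i j ↔ (b,a) ∈ κ j i`. -/
def KappaHyp (n : ℕ) (κ : Fin n → Fin n → Set (ℝ × ℝ)) : Prop :=
  (∀ i j, IsOpen (κ i j)) ∧ (∀ i j, Bornology.IsBounded (κ i j)) ∧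
  (∀ i j, Convex ℝ (κ i j)) ∧ (∀ i, κ i i = ∅) ∧
  (∀ (i j : Fin n) (a b : ℝ), (a, b) ∈ κ i j ↔ (b, a) ∈ κ j i)

/-- `PhiMem n C φ` : `φ` restricted to `[0,1]` is a continuous nondecreasing path whose
image lies in `C`, with `φ 0 − ℝ₊^n ⊆ C` and `φ 1 + ℝ₊^n ⊆ C` (the set `Φ(C)`). -/
def PhiMem (n : ℕ) (C : Set (Fin n → ℝ)) (φ : ℝ → Fin n → ℝ) : Prop :=
  ContinuousOn φ (Icc 0 1) ∧
  (∀ t1 ∈ Icc (0:ℝ) 1, ∀ t2 ∈ Icc (0:ℝ) 1, t1 ≤ t2 → φ t1 ≤ φ t2) ∧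
  (∀ t ∈ Icc (0:ℝ) 1, φ t ∈ C) ∧
  (∀ d : Fin n → ℝ, 0 ≤ d → φ 0 - d ∈ C) ∧
  (∀ d : Fin n → ℝ, 0 ≤ d → φ 1 + d ∈ C)

/-- A priority graph: `E i j ↔ (χ^obs_{ij} ≠ ∅ ∧ ¬ E j i)`. -/
def IsPriorityGraph (n : ℕ) (κ : Fin n → Fin n → Set (ℝ × ℝ))
    (E : Fin n → Fin n → Prop) : Prop :=
  ∀ i j, E i j ↔ (cyl n κ i j ≠ ∅ ∧ ¬ E j i)

/-- Completed obstacle region `χ^obs_G = ⋃_{(i,j) ∈ E(G)} χ^obs_{i≻j}`. -/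
def obsG (n : ℕ) (κ : Fin n → Fin n → Set (ℝ × ℝ))
    (E : Fin n → Fin n → Prop) : Set (Fin n → ℝ) :=
  ⋃ i, ⋃ j, ⋃ (_ : E i j), cylPr n κ i j

/-- `χ^free_G = χ \ χ^obs_G`. -/
def freeG (n : ℕ) (κ : Fin n → Fin n → Set (ℝ × ℝ))
    (E : Fin n → Fin n → Prop) : Set (Fin n → ℝ) :=
  (obsG n κ E)ᶜ

/-- `E` contains a directed cycle. -/
def HasCycle (n : ℕ) (E : Fin n → Fin n → Prop) : Prop :=
  ∃ (m : ℕ) (v : ℕ → Fin n), 0 < m ∧ v m = v 0 ∧ ∀ k < m, E (v k) (v (k+1))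

theorem mem_cylPr_iff {n : ℕ} {κ : Fin n → Fin n → Set (ℝ × ℝ)} {i j : Fin n} (hij : i ≠ j)
    {z : Fin n → ℝ} : z ∈ cylPr n κ i j ↔ ∃ p ∈ κ i j, z i ≤ p.1 ∧ p.2 ≤ z j := by
  constructor
  · rintro ⟨y, hy, a, b, ha, hb, rfl⟩
    refine ⟨_, hy, ?_, ?_⟩ <;> simp [basisVec, hij, hij.symm, ha, hb]
  · rintro ⟨p, hp, h1, h2⟩
    refine ⟨z + (p.1 - z i) • basisVec n i - (z j - p.2) • basisVec n j, ?_,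
      p.1 - z i, z j - p.2, sub_nonneg.2 h1, sub_nonneg.2 h2, by abel⟩
    simpa [cyl, basisVec, hij, hij.symm] using hp

theorem IsPriorityGraph.ne {n : ℕ} {κ : Fin n → Fin n → Set (ℝ × ℝ)}
    {E : Fin n → Fin n → Prop} (hE : IsPriorityGraph n κ E) {i j : Fin n} (h : E i j) :
    i ≠ j := by
  rintro rfl
  exact ((hE i i).1 h).2 h

theorem IsPriorityGraph.mem_freeG_iff {n : ℕ} {κ : Fin n → Fin n → Set (ℝ × ℝ)}
    {E : Fin n → Fin n → Prop} (hE : IsPriorityGraph n κ E) {z : Fin n → ℝ} :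
    z ∈ freeG n κ E ↔ ∀ i j, E i j → ∀ p ∈ κ i j, z i ≤ p.1 → z j < p.2 := by
  simp only [freeG, obsG, mem_compl_iff, mem_iUnion, not_exists]
  refine forall_congr' fun i => forall_congr' fun j => forall_congr' fun h => ?_
  rw [mem_cylPr_iff (hE.ne h)]
  push Not
  rfl

/-- The free region of a priority graph is closed under coordinatewise maxima. -/
theorem IsPriorityGraph.supClosed_freeG {n : ℕ} {κ : Fin n → Fin n → Set (ℝ × ℝ)}
    {E : Fin n → Fin n → Prop} (hE : IsPriorityGraph n κ E) : SupClosed (freeG n κ E) := by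
  intro x hx y hy
  rw [hE.mem_freeG_iff] at *
  intro i j h p hp hi
  obtain ⟨h1, h2⟩ := sup_le_iff.1 hi
  exact max_lt (hx i j h p hp h1) (hy i j h p hp h2)

/-- The free region of a priority graph is closed under coordinatewise minima. -/
theorem IsPriorityGraph.infClosed_freeG {n : ℕ} {κ : Fin n → Fin n → Set (ℝ × ℝ)}
    {E : Fin n → Fin n → Prop} (hE : IsPriorityGraph n κ E) : InfClosed (freeG n κ E) := by
  intro x hx y hy
  rw [hE.mem_freeG_iff] at *
  intro i j h p hp hi
  rcases min_le_iff.1 hi with h1 | h1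
  · exact min_lt_of_left_lt (hx i j h p hp h1)
  · exact min_lt_of_right_lt (hy i j h p hp h1)

/-- A path of `Φ(C)` extends to a monotone curve in `C` defined on all of `ℝ` that is eventually
below and above any given point, and whose ends have their lower and upper cones in `C`. -/
theorem PhiMem.exists_extension {n : ℕ} {C : Set (Fin n → ℝ)} {φ : ℝ → Fin n → ℝ}
    (hφ : PhiMem n C φ) (x : Fin n → ℝ) :
    ∃ (ψ : ℝ → Fin n → ℝ) (M : ℝ), 0 ≤ M ∧ Continuous ψ ∧ Monotone ψ ∧ (∀ t, ψ t ∈ C) ∧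
      ψ (-M) ≤ x ∧ x ≤ ψ M ∧ (∀ z ≤ ψ (-M), z ∈ C) ∧ ∀ z, ψ M ≤ z → z ∈ C := by
  obtain ⟨hc, hm, hC, h0, h1⟩ := hφ
  have lower : ∀ z ≤ φ 0, z ∈ C := fun z hz => by
    simpa using h0 (φ 0 - z) (sub_nonneg.2 hz)
  have upper : ∀ z, φ 1 ≤ z → z ∈ C := fun z hz => by
    simpa using h1 (z - φ 1) (sub_nonneg.2 hz)
  set ψ : ℝ → Fin n → ℝ := fun t i =>
    φ (projIcc 0 1 zero_le_one t) i + (min t 0 + max (t - 1) 0) with hψ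
  have ψ_lo : ∀ t ≤ 0, ψ t = fun i => φ 0 i + t := fun t ht => by
    ext i
    simp [hψ, projIcc_of_le_left _ ht, min_eq_left ht, max_eq_right (by linarith : t - 1 ≤ 0)]
  have ψ_hi : ∀ t, 1 ≤ t → ψ t = fun i => φ 1 i + (t - 1) := fun t ht => by
    ext i
    simp [hψ, projIcc_of_right_le _ ht, min_eq_right (by linarith : (0 : ℝ) ≤ t),
      max_eq_left (by linarith : 0 ≤ t - 1)]
  have b0 : ∀ i, |x i - φ 0 i| ≤ ‖x - φ 0‖ := fun i => norm_le_pi_norm (x - φ 0) i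
  have b1 : ∀ i, |x i - φ 1 i| ≤ ‖x - φ 1‖ := fun i => norm_le_pi_norm (x - φ 1) i
  have n0 := norm_nonneg (x - φ 0)
  have n1 := norm_nonneg (x - φ 1)
  refine ⟨ψ, 1 + ‖x - φ 0‖ + ‖x - φ 1‖, by positivity, ?_, ?_, ?_, ?_, ?_, ?_, ?_⟩
  · have : Continuous fun t : ℝ => φ (projIcc (0 : ℝ) 1 zero_le_one t) :=
      hc.comp_continuous (by fun_prop) fun t => (projIcc (0 : ℝ) 1 zero_le_one t).2
    exact continuous_pi fun i => ((continuous_apply i).comp this).add (by fun_prop)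
  · intro s t hst i
    have := hm _ (projIcc (0 : ℝ) 1 zero_le_one s).2 _ (projIcc (0 : ℝ) 1 zero_le_one t).2
      (monotone_projIcc _ hst) i
    simp only [hψ]
    gcongr
  · intro t
    rcases le_total t 0 with ht | ht
    · rw [ψ_lo t ht]
      exact lower _ fun i => by simpa using ht
    rcases le_total 1 t with ht' | ht'
    · rw [ψ_hi t ht']
      exact upper _ fun i => by simpa using ht'
    · convert hC t ⟨ht, ht'⟩ using 1
      ext i
      simp [hψ, projIcc_of_mem zero_le_one ⟨ht, ht'⟩, ht, ht']
  · rw [ψ_lo _ (by linarith)]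
    intro i
    linarith [neg_abs_le (x i - φ 0 i), b0 i]
  · rw [ψ_hi _ (by linarith)]
    intro i
    linarith [le_abs_self (x i - φ 1 i), b1 i]
  · rw [ψ_lo _ (by linarith)]
    exact fun z hz => lower z fun i => by linarith [hz i]
  · rw [ψ_hi _ (by linarith)]
    exact fun z hz => upper z fun i => by linarith [hz i]

/-- absence of deadlocks: if `Φ(χ^free_G) ≠ ∅` then every configuration
`x ∈ χ^free_G` lies on some path of `Φ(χ^free_G)`. -/
theorem stmt12 (n : ℕ) (hn : 1 ≤ n) (κ : Fin n → Fin n → Set (ℝ × ℝ))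
    (hκ : KappaHyp n κ) (E : Fin n → Fin n → Prop) (hE : IsPriorityGraph n κ E)
    (hfeas : ∃ φ : ℝ → Fin n → ℝ, PhiMem n (freeG n κ E) φ)
    (x : Fin n → ℝ) (hx : x ∈ freeG n κ E) :
    ∃ φ : ℝ → Fin n → ℝ, PhiMem n (freeG n κ E) φ ∧ ∃ t ∈ Icc (0:ℝ) 1, φ t = x := by
  obtain ⟨φ, hφ⟩ := hfeas
  obtain ⟨ψ, M, hM, hc, hm, hC, hlo, hhi, hL, hU⟩ := hφ.exists_extension x
  refine ⟨fun t => x ⊓ ψ (2 * M * (2 * t - 1) + M) ⊔ ψ (2 * M * (2 * t - 1) - M),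
    ⟨?_, ?_, ?_, ?_, ?_⟩, 1 / 2, by norm_num, ?_⟩
  · have hi : ∀ i, Continuous fun t => ψ t i := fun i => (continuous_apply i).comp hc
    refine (continuous_pi fun i => ?_).continuousOn
    exact (continuous_const.min ((hi i).comp (by fun_prop))).max ((hi i).comp (by fun_prop))
  · intro s _ t _ hst
    have h : 2 * M * (2 * s - 1) ≤ 2 * M * (2 * t - 1) := by gcongr
    exact sup_le_sup (inf_le_inf_left _ (hm (by linarith))) (hm (by linarith))
  · exact fun t _ => hE.supClosed_freeG (hE.infClosed_freeG hx (hC _)) (hC _)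
  · intro d hd
    refine hL _ ((sub_le_self _ hd).trans (sup_le (inf_le_right.trans (hm ?_)) (hm ?_))) <;>
      linarith
  · intro d hd
    exact hU _ (((hm (by linarith)).trans le_sup_right).trans (le_add_of_nonneg_right hd))
  · simp [hlo, hhi]
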